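/- Let (X, π) be an n-partite weighted simplicial complex of rank n, let 0 ≤ ℓ ≤ n, and let H be a k-regular labelled graph on the ℓ-element subsets of [n]. Then EC(Qdo) ≥ LS(Udw_{ℓ↔n})·Gap*(H²), where Qdo is the expanderized down-walk. Consequently, for Papx' = Qup·Qdo (the expanderized up-down walk via H²) and Paqx = Qdo·Qup (the expanderized down-up walk via H), one has EC(Papx') ≥ LS(Udw_{ℓ↔n})·Gap*(H²) and EC(Paqx) ≥ LS(Udw_{ℓ↔n})·Gap*(H²). -/

import Mathlib

open scoped Classical
noncomputable section

namespace Expanderized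

/-! ## Generic weighted linear algebra over finite types -/

section Generic

variable {α β γ : Type*}

/-- Inner product `⟨f,g⟩_μ = E_{x∼μ}[f(x)g(x)]` with respect to a weight `μ`. -/
def inner' [Fintype α] (μ : α → ℝ) (f g : α → ℝ) : ℝ := ∑ x, μ x * (f x * g x)

/-- Expectation with respect to `μ`. -/
def expect [Fintype α] (μ : α → ℝ) (f : α → ℝ) : ℝ := ∑ x, μ x * f x

/-- `μ` is a probability distribution. -/
def IsProbDist [Fintype α] (μ : α → ℝ) : Prop := (∀ x, 0 ≤ μ x) ∧ (∑ x, μ x) = 1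

/-- A row-stochastic kernel. -/
def IsRowStochastic [Fintype β] (P : α → β → ℝ) : Prop :=
  (∀ x y, 0 ≤ P x y) ∧ ∀ x, (∑ y, P x y) = 1

/-- Product of two kernels (matrix multiplication). -/
def matMul [Fintype β] (A : α → β → ℝ) (B : β → γ → ℝ) : α → γ → ℝ :=
  fun x z => ∑ y, A x y * B y z

/-- Right action of a kernel on a function (column vector). -/
def mApp [Fintype β] (A : α → β → ℝ) (f : β → ℝ) : α → ℝ :=
  fun x => ∑ y, A x y * f y

/-- Left action of a kernel on a row vector / measure. -/
def rowMul [Fintype α] (μ : α → ℝ) (A : α → β → ℝ) : β → ℝ :=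
  fun y => ∑ x, μ x * A x y

/-- The adjoint of the kernel `P` with respect to the measures `(μ₁, μ₂)`. -/
def adjointKer [Fintype α] [Fintype β] (μ₁ : α → ℝ) (μ₂ : β → ℝ) (P : α → β → ℝ) :
    β → α → ℝ :=
  fun y x => P x y * μ₁ x / μ₂ y

/-- Iterates of a square kernel. -/
def matIter [Fintype α] [DecidableEq α] (A : α → α → ℝ) : ℕ → (α → α → ℝ)
  | 0 => fun x y => if x = y then 1 else 0
  | (t + 1) => matMul (matIter A t) A

/-- The second-largest eigenvalue `λ₂` of a random walk matrix that is reversible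
with respect to `μ`, via its Rayleigh-quotient (Courant–Fischer) characterization. -/
def lambda2 [Fintype α] (μ : α → ℝ) (A : α → α → ℝ) : ℝ :=
  sSup {r | ∃ f : α → ℝ, inner' μ f f = 1 ∧ inner' μ f (fun _ => 1) = 0 ∧
      r = inner' μ f (mApp A f)}

/-- The spectral gap `1 - λ₂`. -/
def specGap [Fintype α] (μ : α → ℝ) (A : α → α → ℝ) : ℝ := 1 - lambda2 μ A

/-- The two-sided expansion `λ(A) = max(λ₂(A), |λ_min(A)|)` of a random walk matrix
reversible with respect to `μ`, via its Rayleigh-quotient characterization. -/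
def twoSided [Fintype α] (μ : α → ℝ) (A : α → α → ℝ) : ℝ :=
  sSup {r | ∃ f : α → ℝ, inner' μ f f = 1 ∧ inner' μ f (fun _ => 1) = 0 ∧
      r = |inner' μ f (mApp A f)|}

/-- The operator norm `‖A‖_{op,μ}`. -/
def opNorm [Fintype α] (μ : α → ℝ) (A : α → α → ℝ) : ℝ :=
  sSup {r | ∃ f : α → ℝ, inner' μ f f = 1 ∧
      r = Real.sqrt (inner' μ (mApp A f) (mApp A f))}

/-- The `Φ`-entropy functional `Ent^Φ_μ(f) = E_μ[Φ(f)] - Φ(E_μ f)`. -/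
def phiEnt [Fintype α] (Φ : ℝ → ℝ) (μ : α → ℝ) (f : α → ℝ) : ℝ :=
  expect μ (fun x => Φ (f x)) - Φ (expect μ f)

/-- `t ↦ t log t`; note `Real.log 0 = 0`, so the convention `0 log 0 = 0` is built in. -/
def nlog (t : ℝ) : ℝ := t * Real.log t

/-- The usual entropy functional `Ent_μ`. -/
def ent [Fintype α] (μ : α → ℝ) (f : α → ℝ) : ℝ := phiEnt nlog μ f

/-- The `Φ`-entropy contraction constant of a kernel `P` with respect to measures
`(μ₁, μ₂)`: the largest `C ≥ 0` such that `Ent^Φ_{μ₁}(Pf) ≤ (1-C)·Ent^Φ_{μ₂}(f)`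
for all nonnegative `f`. -/
def CFphi [Fintype α] [Fintype β] (Φ : ℝ → ℝ) (μ₁ : α → ℝ) (μ₂ : β → ℝ)
    (P : α → β → ℝ) : ℝ :=
  sSup {C | 0 ≤ C ∧ ∀ f : β → ℝ, (∀ y, 0 ≤ f y) →
      phiEnt Φ μ₁ (mApp P f) ≤ (1 - C) * phiEnt Φ μ₂ f}

/-- The entropy contraction constant `EC(P)`. -/
def EC [Fintype α] [Fintype β] (μ₁ : α → ℝ) (μ₂ : β → ℝ) (P : α → β → ℝ) : ℝ :=
  CFphi nlog μ₁ μ₂ P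

/-- The log-Sobolev constant of a reversible kernel `P` with stationary measure `μ`:
the largest `C ≥ 0` with `C·Ent_μ(f²) ≤ ⟨f,(I-P)f⟩_μ` for all nonnegative `f`. -/
def LS [Fintype α] (μ : α → ℝ) (P : α → α → ℝ) : ℝ :=
  sSup {C | 0 ≤ C ∧ ∀ f : α → ℝ, (∀ x, 0 ≤ f x) →
      C * ent μ (fun x => f x ^ 2) ≤ inner' μ f (fun x => f x - mApp P f x)}

/-- The modified log-Sobolev constant of a reversible kernel `P` with stationary
measure `μ`: the largest `C ≥ 0` with `C·Ent_μ(f) ≤ ⟨f,(I-P) log f⟩_μ`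
for all strictly positive `f`. -/
def MLS [Fintype α] (μ : α → ℝ) (P : α → α → ℝ) : ℝ :=
  sSup {C | 0 ≤ C ∧ ∀ f : α → ℝ, (∀ x, 0 < f x) →
      C * ent μ f ≤
        inner' μ f (fun x => Real.log (f x) - mApp P (fun y => Real.log (f y)) x)}

/-- Total variation distance. -/
def tvDist [Fintype α] (μ ν : α → ℝ) : ℝ := (∑ x, |μ x - ν x|) / 2

/-- The `ε`-mixing time of a kernel `P` towards the target distribution `π`. -/
def mixingTime [Fintype α] [DecidableEq α] (P : α → α → ℝ) (π : α → ℝ) (ε : ℝ) : ℕ :=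
  sInf {t : ℕ | ∀ μ₀ : α → ℝ, IsProbDist μ₀ → tvDist (rowMul μ₀ (matIter P t)) π ≤ ε}

end Generic

/-! ## Weighted simplicial complexes -/

/-- A weighted (pure) simplicial complex of rank `n` on a finite vertex set `V`:
a downward-closed collection of faces, all maximal faces of cardinality `n`,
together with a fully supported probability distribution `pi` on the rank `n` faces
(extended by zero to all finsets). -/
structure WComplex (V : Type*) [Fintype V] [DecidableEq V] (n : ℕ) where
  faces : Finset (Finset V)
  pi : Finset V → ℝ
  faces_nonempty : faces.Nonempty
  down_closed : ∀ α ∈ faces, ∀ β ⊆ α, β ∈ faces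
  card_le : ∀ α ∈ faces, α.card ≤ n
  pure : ∀ α ∈ faces, ∃ ω ∈ faces, ω.card = n ∧ α ⊆ ω
  pi_pos : ∀ ω ∈ faces, ω.card = n → 0 < pi ω
  pi_zero_of_not_mem : ∀ ω : Finset V, ω ∉ faces → pi ω = 0
  pi_zero_of_card_ne : ∀ ω : Finset V, ω.card ≠ n → pi ω = 0
  pi_sum : (∑ ω : Finset V, pi ω) = 1

namespace WComplex

variable {V : Type*} [Fintype V] [DecidableEq V] {n : ℕ}

/-- `Pr_{ω∼π}[ω ⊇ α]` (unnormalized level mass of a face). -/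
def mass (K : WComplex V n) (α : Finset V) : ℝ :=
  ∑ ω : Finset V, if α ⊆ ω then K.pi ω else 0

/-- The induced distribution `π_j` on the `j`-th level `X^(j)`. -/
def level (K : WComplex V n) (j : ℕ) : Finset V → ℝ :=
  fun α => if α.card = j then ((n.choose j : ℝ))⁻¹ * K.mass α else 0

/-- The up-walk `Up_{ℓ→k}`. -/
def up (K : WComplex V n) (ℓ k : ℕ) : Finset V → Finset V → ℝ :=
  fun a b =>
    if a.card = ℓ ∧ b.card = k ∧ a ⊆ b then
      (((n - ℓ).choose (k - ℓ) : ℝ))⁻¹ * (K.mass b / K.mass a)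
    else 0

/-- The down-walk `Down_{k→ℓ}`. -/
def down (K : WComplex V n) (k ℓ : ℕ) : Finset V → Finset V → ℝ :=
  fun a b => if a.card = k ∧ b.card = ℓ ∧ b ⊆ a then ((k.choose ℓ : ℝ))⁻¹ else 0

/-- The down-up walk `Duw_{n↔ℓ} = Down_{n→ℓ}·Up_{ℓ→n}` on `X^(n)`. -/
def downUp (K : WComplex V n) (ℓ : ℕ) : Finset V → Finset V → ℝ :=
  matMul (K.down n ℓ) (K.up ℓ n)

/-- The up-down walk `Udw_{ℓ↔n} = Up_{ℓ→n}·Down_{n→ℓ}` on `X^(ℓ)`. -/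
def upDown (K : WComplex V n) (ℓ : ℕ) : Finset V → Finset V → ℝ :=
  matMul (K.up ℓ n) (K.down n ℓ)

/-- The top-level distribution `π^(ω̂)` of the link complex of the face `z`. -/
def linkPi (K : WComplex V n) (z : Finset V) : Finset V → ℝ :=
  fun α => if Disjoint α z then K.pi (z ∪ α) / K.mass z else 0

/-- Unnormalized level mass in the link of `z`. -/
def linkMass (K : WComplex V n) (z α : Finset V) : ℝ :=
  ∑ β : Finset V, if α ⊆ β then K.linkPi z β else 0

/-- The induced distribution `π^(ω̂)_j` on the `j`-th level of the link of `z`. -/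
def linkLevel (K : WComplex V n) (z : Finset V) (j : ℕ) : Finset V → ℝ :=
  fun α => if α.card = j then (((n - z.card).choose j : ℝ))⁻¹ * K.linkMass z α else 0

/-- The up-walk `Up^{ω̂}_{ℓ→k}` of the link complex of `z`. -/
def linkUp (K : WComplex V n) (z : Finset V) (ℓ k : ℕ) : Finset V → Finset V → ℝ :=
  fun a b =>
    if a.card = ℓ ∧ b.card = k ∧ a ⊆ b then
      ((((n - z.card) - ℓ).choose (k - ℓ) : ℝ))⁻¹ * (K.linkMass z b / K.linkMass z a)
    else 0

/-- The vertex marginal `π^(ω̂)_1` of the link of `z`, as a distribution on vertices. -/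
def linkVertex (K : WComplex V n) (z : Finset V) : V → ℝ :=
  fun x => K.linkLevel z 1 {x}

/-- The link random-walk matrix `M_ω̂` of a face `z` (with `|z| ≤ n-2`). -/
def linkMat (K : WComplex V n) (z : Finset V) : V → V → ℝ :=
  fun x y =>
    if x ≠ y then (K.mass (z ∪ {x, y}) / K.mass (z ∪ {x})) / ((n : ℝ) - z.card - 1)
    else 0

/-- The local `Φ`-entropy contraction constant `lc_Φ(ω̂)`: the smallest `c ≥ 0` with
`Ent^Φ_{π^(ω̂)_1}(Up^{ω̂}_{1→n'} g) ≤ c·Ent^Φ_{π^(ω̂)_{n'}}(g)` for all `g ≥ 0`,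
where `n' = n - |ω̂|`. -/
def lcPhi (K : WComplex V n) (Φ : ℝ → ℝ) (z : Finset V) : ℝ :=
  sInf {c | 0 ≤ c ∧ ∀ g : Finset V → ℝ, (∀ x, 0 ≤ g x) →
      phiEnt Φ (K.linkLevel z 1) (mApp (K.linkUp z 1 (n - z.card)) g)
        ≤ c * phiEnt Φ (K.linkLevel z (n - z.card)) g}

/-- The local entropy contraction constant `lec(ω̂)` (the case `Φ(t) = t log t`). -/
def lec (K : WComplex V n) (z : Finset V) : ℝ := K.lcPhi nlog z

end WComplex

/-! ## Partite complexes, auxiliary expander graphs, and expanderized walks -/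

section Partite

variable {n : ℕ} {U : Type*} [Fintype U] [DecidableEq U]

/-- The type of a face of an `n`-partite complex: the set of sides it meets. -/
def typ (α : Finset (Fin n × U)) : Finset (Fin n) := α.image Prod.fst

/-- The restriction `ω_S` of a face to the sides in `S`. -/
def restrict (ω : Finset (Fin n × U)) (S : Finset (Fin n)) : Finset (Fin n × U) :=
  ω.filter fun v => v.1 ∈ S

/-- An `n`-partite complex: every facet contains exactly one vertex from each side. -/
def IsPartite (K : WComplex (Fin n × U) n) : Prop :=
  ∀ ω ∈ K.faces, ω.card = n → (typ ω).card = n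

/-- `H` is a `k`-regular graph all of whose edges join `ℓ`-element subsets of `[n]`. -/
def IsRegularOnSubsets (H : SimpleGraph (Finset (Fin n))) (ℓ k : ℕ) : Prop :=
  (∀ S T, H.Adj S T → S.card = ℓ ∧ T.card = ℓ) ∧
  (∀ S : Finset (Fin n), S.card = ℓ → (Finset.univ.filter fun T => H.Adj S T).card = k)

/-- The simple random walk matrix of a `k`-regular graph `H`. -/
def walkMat (H : SimpleGraph (Finset (Fin n))) (k : ℕ) :
    Finset (Fin n) → Finset (Fin n) → ℝ :=
  fun S T => if H.Adj S T then (k : ℝ)⁻¹ else 0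

/-- The uniform distribution on `ℓ`-element subsets of `[n]`. -/
def unifSubsets (n ℓ : ℕ) : Finset (Fin n) → ℝ :=
  fun S => if S.card = ℓ then ((n.choose ℓ : ℝ))⁻¹ else 0

/-- The two-sided expansion `λ(H)` of `H`. -/
def lamH (H : SimpleGraph (Finset (Fin n))) (ℓ k : ℕ) : ℝ :=
  twoSided (unifSubsets n ℓ) (walkMat H k)

/-- The two-sided expansion `λ(H²)` of the square of `H` (i.e. of the graph whose
random walk matrix is the square of that of `H`). -/
def lamHsq (H : SimpleGraph (Finset (Fin n))) (ℓ k : ℕ) : ℝ :=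
  twoSided (unifSubsets n ℓ) (matMul (walkMat H k) (walkMat H k))

/-- `Pr_{ω∼π}[ω_{typ a} = a ∧ ω_{typ b} = b]`. -/
def jointMass (K : WComplex (Fin n × U) n) (a b : Finset (Fin n × U)) : ℝ :=
  ∑ ω : Finset (Fin n × U),
    if restrict ω (typ a) = a ∧ restrict ω (typ b) = b then K.pi ω else 0

/-- The expanderized up-down walk with type-transition matrix `W`; taking
`W = walkMat H k` gives `UpDown(X, π, H)`, and taking `W = (walkMat H k)²`
gives `UpDown(X, π, H²)`.  Its `(ω̂, ω̃)` entry is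
`W(typ ω̂, typ ω̃) · Pr_{ω∼π}[ω_{typ ω̃} = ω̃ ∣ ω_{typ ω̂} = ω̂]`. -/
def expUpDown (K : WComplex (Fin n × U) n)
    (W : Finset (Fin n) → Finset (Fin n) → ℝ) :
    Finset (Fin n × U) → Finset (Fin n × U) → ℝ :=
  fun a b => W (typ a) (typ b) * (jointMass K a b / jointMass K a a)

/-- The expanderized down-walk `Qdo` from `X^(n) × binom([n],ℓ)` to `X^(ℓ)`. -/
def Qdown (K : WComplex (Fin n × U) n) (H : SimpleGraph (Finset (Fin n))) (k : ℕ) :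
    Finset (Fin n × U) × Finset (Fin n) → Finset (Fin n × U) → ℝ :=
  fun p b => if H.Adj p.2 (typ b) ∧ b ⊆ p.1 then (k : ℝ)⁻¹ else 0

/-- The expanderized up-walk `Qup` from `X^(ℓ)` to `X^(n) × binom([n],ℓ)`
(the adjoint of `Qdown` with respect to `(π_n ⊗ Unif, π_ℓ)`). -/
def Qup (K : WComplex (Fin n × U) n) (H : SimpleGraph (Finset (Fin n))) (k : ℕ) :
    Finset (Fin n × U) → Finset (Fin n × U) × Finset (Fin n) → ℝ :=
  fun b p =>
    (if H.Adj p.2 (typ b) then (k : ℝ)⁻¹ else 0) *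
      ((if b ⊆ p.1 then K.pi p.1 else 0) / K.mass b)

/-- The expanderized down-up walk `Paqx = Qdo·Qup` on `X^(n) × binom([n],ℓ)`. -/
def expDownUp (K : WComplex (Fin n × U) n) (H : SimpleGraph (Finset (Fin n))) (k : ℕ) :
    Finset (Fin n × U) × Finset (Fin n) → Finset (Fin n × U) × Finset (Fin n) → ℝ :=
  matMul (Qdown K H k) (Qup K H k)

/-- The product distribution `π_n ⊗ Unif_{binom([n],ℓ)}`. -/
def prodDist (K : WComplex (Fin n × U) n) (ℓ : ℕ) :
    Finset (Fin n × U) × Finset (Fin n) → ℝ :=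
  fun p => K.pi p.1 * unifSubsets n ℓ p.2

end Partite

/-! ## List colorings -/

section Coloring

variable {n : ℕ} {Col : Type*} [Fintype Col] [DecidableEq Col]

/-- The degree of a vertex in a graph. -/
def degree' {W : Type*} [Fintype W] (G : SimpleGraph W) (v : W) : ℕ :=
  (Finset.univ.filter fun u => G.Adj v u).card

/-- A proper list coloring of `(G, L)`. -/
def IsProperColoring (G : SimpleGraph (Fin n)) (L : Fin n → Finset Col)
    (c : Fin n → Col) : Prop :=
  (∀ v, c v ∈ L v) ∧ ∀ u v, G.Adj u v → c u ≠ c v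

/-- The face `{(v, c v) : v}` associated to a coloring `c`. -/
def colorFace (c : Fin n → Col) : Finset (Fin n × Col) :=
  Finset.univ.image fun v => (v, c v)

/-- `Y` is the list-coloring complex of `(G, L)`: its faces are the subsets of proper
list colorings and its weight is the uniform distribution on proper list colorings. -/
def IsColoringComplex (G : SimpleGraph (Fin n)) (L : Fin n → Finset Col)
    (Y : WComplex (Fin n × Col) n) : Prop :=
  (∀ α : Finset (Fin n × Col),
      α ∈ Y.faces ↔ ∃ c : Fin n → Col, IsProperColoring G L c ∧ α ⊆ colorFace c) ∧
  (∀ ω : Finset (Fin n × Col),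
      Y.pi ω =
        ∑ c : Fin n → Col,
          if IsProperColoring G L c ∧ ω = colorFace c then
            ((Finset.univ.filter fun c' : Fin n → Col =>
                IsProperColoring G L c').card : ℝ)⁻¹
          else 0)

end Coloring

/-! ## Ising models -/

section Ising

variable {n : ℕ}

/-- `±1` value of a Boolean spin. -/
def signR (b : Bool) : ℝ := if b then 1 else -1

/-- The (unnormalized) Ising weight `exp(½⟨x,Jx⟩ + ⟨h,x⟩)`. -/
def isingWeight (J : Matrix (Fin n) (Fin n) ℝ) (h : Fin n → ℝ) (x : Fin n → Bool) : ℝ :=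
  Real.exp ((1 / 2) * (∑ i, ∑ j, J i j * (signR (x i) * signR (x j))) +
    ∑ i, h i * signR (x i))

/-- The face `{(i, x i) : i}` associated to a spin configuration `x`. -/
def spinFace (x : Fin n → Bool) : Finset (Fin n × Bool) :=
  Finset.univ.image fun i => (i, x i)

/-- `Y` is the Ising complex of `(J, h)`. -/
def IsIsingComplex (J : Matrix (Fin n) (Fin n) ℝ) (h : Fin n → ℝ)
    (Y : WComplex (Fin n × Bool) n) : Prop :=
  (∀ α : Finset (Fin n × Bool), α ∈ Y.faces ↔ ∃ x : Fin n → Bool, α ⊆ spinFace x) ∧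
  (∀ ω : Finset (Fin n × Bool),
      Y.pi ω =
        (∑ x : Fin n → Bool, if ω = spinFace x then isingWeight J h x else 0) /
          ∑ x : Fin n → Bool, isingWeight J h x)

/-- The `ℓ₂ → ℓ₂` operator norm of a square matrix. -/
def matOpNorm {m : ℕ} (J : Matrix (Fin m) (Fin m) ℝ) : ℝ :=
  sSup {r | ∃ v : Fin m → ℝ, (∑ i, v i ^ 2) = 1 ∧
      r = Real.sqrt (∑ i, (J.mulVec v i) ^ 2)}

/-- The `2×2` principal submatrix of `J` at rows/columns `i, j`. -/
def principal2 (J : Matrix (Fin n) (Fin n) ℝ) (i j : Fin n) : Matrix (Fin 2) (Fin 2) ℝ :=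
  !![J i i, J i j; J j i, J j j]

/-- `‖h‖_∞`. -/
def normInf (h : Fin n → ℝ) : ℝ := sSup (Set.range fun i => |h i|)

/-- `‖h‖_₁`. -/
def norm1 (h : Fin n → ℝ) : ℝ := ∑ i, |h i|

end Ising

end Expanderized

namespace Expanderized

section EntropyContraction

variable {α β γ : Type*}

lemma sq_sub_le_nlog {g m : ℝ} (hg : 0 ≤ g) (hm : 0 < m) :
    2 * g ^ 2 - 2 * √m * g ≤ nlog (g ^ 2) - g ^ 2 * Real.log m := by
  unfold nlog
  rcases hg.eq_or_lt with rfl | hg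
  · simp
  have hs : 0 < √m := Real.sqrt_pos.2 hm
  have h1 : Real.log (√m / g) ≤ √m / g - 1 := Real.log_le_sub_one_of_pos (by positivity)
  rw [Real.log_div hs.ne' hg.ne', Real.log_sqrt hm.le] at h1
  have h2 := mul_le_mul_of_nonneg_left h1 (sq_nonneg g)
  have h3 : g ^ 2 * (√m / g - 1) = √m * g - g ^ 2 := by field_simp
  rw [Real.log_pow]
  push_cast
  linarith

/-- The entropy of `g²` dominates the variance of `g`. -/
lemma sq_sub_sq_le_nlog [Fintype β] {w g : β → ℝ} (hw : ∀ y, 0 ≤ w y)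
    (hg : ∀ y, 0 ≤ g y) :
    ∑ y, w y * g y ^ 2 - (∑ y, w y * g y) ^ 2 ≤
      ∑ y, w y * nlog (g y ^ 2) - nlog (∑ y, w y * g y ^ 2) := by
  set m := ∑ y, w y * g y ^ 2 with hm
  set a := ∑ y, w y * g y with ha
  have hm0 : 0 ≤ m := Finset.sum_nonneg fun y _ => mul_nonneg (hw y) (sq_nonneg _)
  rcases hm0.eq_or_lt with h0 | hpos
  · have hz : ∀ y, w y * g y ^ 2 = 0 := fun y =>
      (Finset.sum_eq_zero_iff_of_nonneg
        (fun y _ => mul_nonneg (hw y) (sq_nonneg _))).1 h0.symm y (Finset.mem_univ y)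
    have hz' : ∑ y, w y * nlog (g y ^ 2) = 0 :=
      Finset.sum_eq_zero fun y _ => by unfold nlog; rw [← mul_assoc, hz, zero_mul]
    rw [hz', ← h0]
    simp only [nlog]
    nlinarith [sq_nonneg a]
  · have h := Finset.sum_le_sum (s := Finset.univ) fun y _ =>
      mul_le_mul_of_nonneg_left (sq_sub_le_nlog (hg y) hpos) (hw y)
    have e1 : ∑ y, w y * (2 * g y ^ 2 - 2 * √m * g y) = 2 * m - 2 * √m * a := by
      rw [hm, ha, Finset.mul_sum, Finset.mul_sum, ← Finset.sum_sub_distrib]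
      exact Finset.sum_congr rfl fun y _ => by ring
    have e2 : ∑ y, w y * (nlog (g y ^ 2) - g y ^ 2 * Real.log m) =
        ∑ y, w y * nlog (g y ^ 2) - nlog m := by
      unfold nlog
      nth_rewrite 3 [hm]
      rw [Finset.sum_mul, ← Finset.sum_sub_distrib]
      exact Finset.sum_congr rfl fun y _ => by ring
    rw [e1, e2] at h
    nlinarith [sq_nonneg (√m - a), Real.sq_sqrt hm0]

lemma sq_sum_le_sum_sq [Fintype β] {w : β → ℝ} (hw : ∀ y, 0 ≤ w y) (hw1 : ∑ y, w y = 1)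
    (g : β → ℝ) : (∑ y, w y * g y) ^ 2 ≤ ∑ y, w y * g y ^ 2 := by
  set a := ∑ y, w y * g y with ha
  have h : 0 ≤ ∑ y, w y * (g y - a) ^ 2 :=
    Finset.sum_nonneg fun y _ => mul_nonneg (hw y) (sq_nonneg _)
  have e : ∑ y, w y * (g y - a) ^ 2 =
      ∑ y, w y * g y ^ 2 - 2 * a * ∑ y, w y * g y + a ^ 2 * ∑ y, w y := by
    rw [Finset.mul_sum _ _ (2 * a), Finset.mul_sum _ _ (a ^ 2), ← Finset.sum_sub_distrib,
      ← Finset.sum_add_distrib]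
    exact Finset.sum_congr rfl fun y _ => by ring
  rw [e, hw1, ← ha] at h
  linarith

lemma ent_nonneg [Fintype α] {μ f : α → ℝ} (hμ : IsProbDist μ) (hf : ∀ x, 0 ≤ f x) :
    0 ≤ ent μ f := by
  have h := sq_sub_sq_le_nlog hμ.1 (g := fun x => √(f x)) fun x => Real.sqrt_nonneg _
  have h' := sq_sum_le_sum_sq hμ.1 hμ.2 fun x => √(f x)
  simp only [fun x => Real.sq_sqrt (hf x)] at h h'
  simp only [ent, phiEnt, expect]
  linarith

lemma mApp_matMul [Fintype β] [Fintype γ] (A : α → β → ℝ) (B : β → γ → ℝ) (f : γ → ℝ) :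
    mApp (matMul A B) f = mApp A (mApp B f) := by
  funext x
  simp only [mApp, matMul, Finset.sum_mul, Finset.mul_sum]
  rw [Finset.sum_comm]
  exact Finset.sum_congr rfl fun y _ => Finset.sum_congr rfl fun z _ => by ring

lemma mApp_nonneg [Fintype β] {A : α → β → ℝ} (hA : ∀ x y, 0 ≤ A x y)
    {f : β → ℝ} (hf : ∀ y, 0 ≤ f y) (x : α) :
    0 ≤ mApp A f x :=
  Finset.sum_nonneg fun y _ => mul_nonneg (hA x y) (hf y)

lemma matMul_nonneg [Fintype β] {A : α → β → ℝ} {B : β → γ → ℝ} (hA : ∀ x y, 0 ≤ A x y)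
    (hB : ∀ y z, 0 ≤ B y z) (x : α) (z : γ) : 0 ≤ matMul A B x z :=
  Finset.sum_nonneg fun y _ => mul_nonneg (hA x y) (hB y z)

/-- `A` is a Markov kernel (outside a `μ₁`-null set of rows) carrying `μ₁` to `μ₂`. -/
structure IsTransport [Fintype α] [Fintype β] (μ₁ : α → ℝ) (μ₂ : β → ℝ)
    (A : α → β → ℝ) : Prop where
  nonneg : ∀ x y, 0 ≤ A x y
  row_sum : ∀ x, μ₁ x ≠ 0 → ∑ y, A x y = 1
  expect_eq : ∀ h : β → ℝ, expect μ₁ (mApp A h) = expect μ₂ h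

variable [Fintype α] [Fintype β] {μ₁ : α → ℝ} {μ₂ : β → ℝ} {A : α → β → ℝ}

/-- The entropy lost under a kernel is at least the average local variance of the root. -/
lemma IsTransport.le_ent_sub_ent (hA : IsTransport μ₁ μ₂ A) (hμ : ∀ x, 0 ≤ μ₁ x)
    {g : β → ℝ} (hg : ∀ y, 0 ≤ g y) :
    expect μ₂ (fun y => g y ^ 2) - expect μ₁ (fun x => mApp A g x ^ 2) ≤
      ent μ₂ (fun y => g y ^ 2) - ent μ₁ (mApp A fun y => g y ^ 2) := by
  simp only [ent, phiEnt]
  rw [hA.expect_eq, ← hA.expect_eq (fun y => g y ^ 2), ← hA.expect_eq fun y => nlog (g y ^ 2)]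
  suffices h : expect μ₁ (mApp A fun y => g y ^ 2) - expect μ₁ (fun x => mApp A g x ^ 2) ≤
      expect μ₁ (mApp A fun y => nlog (g y ^ 2)) -
        expect μ₁ (fun x => nlog (mApp A (fun y => g y ^ 2) x)) by linarith
  simp only [expect]
  rw [← Finset.sum_sub_distrib, ← Finset.sum_sub_distrib]
  refine Finset.sum_le_sum fun x _ => ?_
  rw [← mul_sub, ← mul_sub]
  by_cases hx : μ₁ x = 0
  · simp [hx]
  · exact mul_le_mul_of_nonneg_left
      (sq_sub_sq_le_nlog (hA.nonneg x) hg) (hμ x)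

lemma IsTransport.expect_sq_le (hA : IsTransport μ₁ μ₂ A) (hμ : ∀ x, 0 ≤ μ₁ x) (g : β → ℝ) :
    expect μ₁ (fun x => mApp A g x ^ 2) ≤ expect μ₂ (fun y => g y ^ 2) := by
  rw [← hA.expect_eq]
  refine Finset.sum_le_sum fun x _ => ?_
  by_cases hx : μ₁ x = 0
  · simp [hx]
  · exact mul_le_mul_of_nonneg_left
      (sq_sum_le_sum_sq (hA.nonneg x) (hA.row_sum x hx) g) (hμ x)

/-- The data processing inequality. -/
lemma IsTransport.ent_mApp_le (hA : IsTransport μ₁ μ₂ A) (hμ : ∀ x, 0 ≤ μ₁ x)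
    {f : β → ℝ} (hf : ∀ y, 0 ≤ f y) : ent μ₁ (mApp A f) ≤ ent μ₂ f := by
  have h1 := hA.le_ent_sub_ent hμ (g := fun y => √(f y)) fun y => Real.sqrt_nonneg _
  have h2 := hA.expect_sq_le hμ fun y => √(f y)
  simp only [fun y => Real.sq_sqrt (hf y)] at h1 h2
  linarith

lemma LS_nonneg (μ : α → ℝ) (P : α → α → ℝ) : 0 ≤ LS μ P :=
  Real.sSup_nonneg fun _ hC => hC.1

lemma LS_mul_ent_le {μ : α → ℝ} {P : α → α → ℝ} (hμ : IsProbDist μ) {g : α → ℝ}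
    (hg : ∀ x, 0 ≤ g x) (hD : 0 ≤ inner' μ g (fun x => g x - mApp P g x)) :
    LS μ P * ent μ (fun x => g x ^ 2) ≤ inner' μ g (fun x => g x - mApp P g x) := by
  rcases (ent_nonneg hμ fun x => sq_nonneg (g x)).eq_or_lt with h | h
  · rw [← h, mul_zero]
    exact hD
  · rw [← le_div_iff₀ h]
    exact Real.sSup_le (fun C hC => (le_div_iff₀ h).2 (hC.2 g hg)) (by positivity)

lemma le_one_of_contraction (hμ : IsProbDist μ₁) (hA : ∀ x y, 0 ≤ A x y) {f : β → ℝ}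
    (hf : ∀ y, 0 ≤ f y) (hpos : 0 < ent μ₂ f) {C : ℝ}
    (hC : ent μ₁ (mApp A f) ≤ (1 - C) * ent μ₂ f) : C ≤ 1 := by
  have h := (ent_nonneg hμ (mApp_nonneg hA hf)).trans hC
  by_contra! hlt
  nlinarith

lemma le_EC (hμ : IsProbDist μ₁) (hA : ∀ x y, 0 ≤ A x y) {f : β → ℝ}
    (hf : ∀ y, 0 ≤ f y) (hpos : 0 < ent μ₂ f) {C : ℝ} (hC0 : 0 ≤ C)
    (hC : ∀ f : β → ℝ, (∀ y, 0 ≤ f y) → ent μ₁ (mApp A f) ≤ (1 - C) * ent μ₂ f) :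
    C ≤ EC μ₁ μ₂ A :=
  le_csSup ⟨1, fun _ hD => le_one_of_contraction hμ hA hf hpos (hD.2 f hf)⟩ ⟨hC0, hC⟩

end EntropyContraction

section Expansion

variable {α : Type*} [Fintype α] {u : α → ℝ} {W : α → α → ℝ}

lemma isTransport_of_symm (hW : ∀ x y, 0 ≤ W x y) (hrow : ∀ x, u x ≠ 0 → ∑ y, W x y = 1)
    (hsym : ∀ x y, u x * W x y = u y * W y x) : IsTransport u u W where
  nonneg := hW
  row_sum := hrow
  expect_eq h := by
    simp only [expect, mApp, Finset.mul_sum]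
    rw [Finset.sum_comm]
    refine Finset.sum_congr rfl fun y _ => ?_
    have e : ∀ x, u x * (W x y * h y) = u y * h y * W y x := fun x => by
      rw [← mul_assoc, hsym]; ring
    simp only [e]
    rw [← Finset.mul_sum]
    by_cases hy : u y = 0
    · simp [hy]
    · rw [hrow y hy, mul_one]

lemma inner'_mApp_sq (hsym : ∀ x y, u x * W x y = u y * W y x) (f : α → ℝ) :
    inner' u f (mApp (matMul W W) f) = expect u (fun x => mApp W f x ^ 2) := by
  rw [mApp_matMul]
  have key : ∀ g : α → ℝ, inner' u f (mApp W g) = inner' u (mApp W f) g := fun g => by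
    simp only [inner', mApp, Finset.mul_sum, Finset.sum_mul]
    rw [Finset.sum_comm]
    refine Finset.sum_congr rfl fun y _ => Finset.sum_congr rfl fun x _ => ?_
    linear_combination f x * g y * hsym x y
  rw [key]
  exact Finset.sum_congr rfl fun x _ => by ring

lemma twoSided_sq_le_one (hu : ∀ x, 0 ≤ u x) (hT : IsTransport u u W)
    (hsym : ∀ x y, u x * W x y = u y * W y x) {f : α → ℝ} (hf : inner' u f f = 1) :
    |inner' u f (mApp (matMul W W) f)| ≤ 1 := by
  have h0 : 0 ≤ expect u (fun x => mApp W f x ^ 2) :=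
    Finset.sum_nonneg fun x _ => mul_nonneg (hu x) (sq_nonneg _)
  rw [inner'_mApp_sq hsym, abs_of_nonneg h0, ← hf]
  refine (hT.expect_sq_le hu f).trans_eq ?_
  exact Finset.sum_congr rfl fun x _ => by ring

/-- The Poincaré inequality for the square of a reversible walk. -/
lemma twoSided_sq_poincare (hu : IsProbDist u) (hT : IsTransport u u W)
    (hsym : ∀ x y, u x * W x y = u y * W y x) (F : α → ℝ) :
    (1 - twoSided u (matMul W W)) * (expect u (fun x => F x ^ 2) - expect u F ^ 2) ≤
      expect u (fun x => F x ^ 2) - expect u (fun x => mApp W F x ^ 2) := by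
  set m := expect u F with hm
  set v := expect u (fun x => F x ^ 2) - m ^ 2 with hv
  set lam := twoSided u (matMul W W) with hlam
  have hu1 := hu.2
  have hmean : expect u (fun x => F x - m) = 0 := by
    simp only [expect, mul_sub, Finset.sum_sub_distrib, ← Finset.sum_mul, hu1]
    rw [hm, expect]; ring
  have hvar : expect u (fun x => (F x - m) ^ 2) = v := by
    have e : ∀ x, u x * (F x - m) ^ 2 = u x * F x ^ 2 - 2 * m * (u x * F x) + m ^ 2 * u x :=
      fun x => by ring
    simp only [expect, e, Finset.sum_sub_distrib, Finset.sum_add_distrib, ← Finset.mul_sum, hu1]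
    rw [hv, hm]; simp only [expect]; ring
  have hWh : expect u (fun x => mApp W (fun y => F y - m) x ^ 2) =
      expect u (fun x => mApp W F x ^ 2) - m ^ 2 := by
    have e : ∀ x, u x * mApp W (fun y => F y - m) x ^ 2 =
        u x * mApp W F x ^ 2 - 2 * m * (u x * mApp W F x) + m ^ 2 * u x := fun x => by
      by_cases hx : u x = 0
      · simp [hx]
      · have : mApp W (fun y => F y - m) x = mApp W F x - m := by
          simp only [mApp, mul_sub, Finset.sum_sub_distrib, ← Finset.sum_mul,
            hT.row_sum x hx, one_mul]
        rw [this]; ring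
    have hst := hT.expect_eq F
    simp only [expect] at hst hm ⊢
    simp only [e, Finset.sum_sub_distrib, Finset.sum_add_distrib, ← Finset.mul_sum, hu1, hst,
      ← hm]
    ring
  suffices h : expect u (fun x => mApp W (fun y => F y - m) x ^ 2) ≤ lam * v by
    rw [hWh] at h; linarith
  have hle := hT.expect_sq_le hu.1 fun y => F y - m
  rw [hvar] at hle
  have hv0 : 0 ≤ v := hvar ▸ Finset.sum_nonneg fun x _ => mul_nonneg (hu.1 x) (sq_nonneg _)
  rcases hv0.eq_or_lt with h0 | hpos
  · rw [← h0] at hle ⊢; linarith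
  set f : α → ℝ := fun x => (F x - m) / √v with hf
  have hs : √v ≠ 0 := (Real.sqrt_pos.2 hpos).ne'
  have hf1 : inner' u f f = 1 := by
    have e : ∀ x, u x * (f x * f x) = u x * (F x - m) ^ 2 / v := fun x => by
      simp only [hf]
      rw [div_mul_div_comm, Real.mul_self_sqrt hv0]; ring
    simp only [inner', e, ← Finset.sum_div]
    simp only [expect] at hvar
    rw [hvar, div_self hpos.ne']
  have hf0 : inner' u f (fun _ => 1) = 0 := by
    have e : ∀ x, u x * (f x * 1) = u x * (F x - m) / √v := fun x => by simp only [hf]; ring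
    simp only [inner', e, ← Finset.sum_div]
    simp only [expect] at hmean
    rw [hmean, zero_div]
  have hmem : |inner' u f (mApp (matMul W W) f)| ≤ lam :=
    le_csSup ⟨1, by rintro r ⟨f, h1, -, rfl⟩; exact twoSided_sq_le_one hu.1 hT hsym h1⟩
      ⟨f, hf1, hf0, rfl⟩
  have hWf : inner' u f (mApp (matMul W W) f) =
      expect u (fun x => mApp W (fun y => F y - m) x ^ 2) / v := by
    rw [inner'_mApp_sq hsym]
    simp only [expect, Finset.sum_div]
    refine Finset.sum_congr rfl fun x _ => ?_
    have : mApp W f x = mApp W (fun y => F y - m) x / √v := by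
      simp only [mApp, hf, Finset.sum_div]
      exact Finset.sum_congr rfl fun y _ => by ring
    rw [this, div_pow, Real.sq_sqrt hv0]; ring
  rw [hWf] at hmem
  exact (div_le_iff₀ hpos).1 ((le_abs_self _).trans hmem)

end Expansion

end Expanderized

namespace Expanderized

namespace WComplex

variable {V : Type*} [Fintype V] [DecidableEq V] {n ℓ : ℕ} (K : WComplex V n)

lemma mem_faces_of_pi_ne_zero {ω : Finset V} (h : K.pi ω ≠ 0) : ω ∈ K.faces ∧ ω.card = n :=
  ⟨by_contra fun h' => h (K.pi_zero_of_not_mem ω h'),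
    by_contra fun h' => h (K.pi_zero_of_card_ne ω h')⟩

lemma pi_nonneg (ω : Finset V) : 0 ≤ K.pi ω := by
  by_cases h : K.pi ω = 0
  · exact h.ge
  · exact (K.pi_pos ω (K.mem_faces_of_pi_ne_zero h).1 (K.mem_faces_of_pi_ne_zero h).2).le

lemma mass_nonneg (a : Finset V) : 0 ≤ K.mass a :=
  Finset.sum_nonneg fun ω _ => by
    split_ifs
    exacts [K.pi_nonneg ω, le_rfl]

lemma level_nonneg (a : Finset V) : 0 ≤ K.level ℓ a := by
  unfold level
  split_ifs
  · exact mul_nonneg (by positivity) (K.mass_nonneg a)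
  · exact le_rfl

lemma pi_le_mass {a ω : Finset V} (h : a ⊆ ω) : K.pi ω ≤ K.mass a := by
  have h' := Finset.single_le_sum (s := Finset.univ)
    (f := fun ω => if a ⊆ ω then K.pi ω else 0)
    (fun ω _ => by split_ifs; exacts [K.pi_nonneg ω, le_rfl]) (Finset.mem_univ ω)
  simp only [if_pos h] at h'
  exact h'

lemma mass_ne_zero {a ω : Finset V} (h : a ⊆ ω) (hω : K.pi ω ≠ 0) : K.mass a ≠ 0 :=
  (((K.pi_nonneg ω).lt_of_ne' hω).trans_le (K.pi_le_mass h)).ne'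

lemma mass_eq_pi {b : Finset V} (hb : b.card = n) : K.mass b = K.pi b := by
  unfold mass
  rw [Finset.sum_eq_single b]
  · simp
  · intro ω _ hne
    split_ifs with h
    · refine K.pi_zero_of_card_ne ω fun hc => hne ?_
      exact (Finset.eq_of_subset_of_card_le h (by omega)).symm
    · rfl
  · simp

/-- The up-walk to the top level is adjoint to the down-walk. -/
lemma level_mul_up (a b : Finset V) :
    K.level ℓ a * K.up ℓ n a b = K.pi b * K.down n ℓ b a := by
  unfold level up down
  by_cases ha : a.card = ℓ
  swap
  · simp [ha]
  by_cases hab : a ⊆ b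
  swap
  · simp [hab]
  by_cases hb : b.card = n
  swap
  · simp [hb]
  simp only [ha, hab, hb, and_self, if_true, Nat.choose_self, Nat.cast_one, inv_one, one_mul,
    K.mass_eq_pi hb]
  by_cases h0 : K.pi b = 0
  · simp [h0]
  · have := K.mass_ne_zero hab h0
    field_simp

lemma inner'_upDown (g : Finset V → ℝ) :
    inner' (K.level ℓ) g (fun a => g a - mApp (K.upDown ℓ) g a) =
      expect (K.level ℓ) (fun a => g a ^ 2) -
        ∑ ω, K.pi ω * mApp (K.down n ℓ) g ω ^ 2 := by
  have h : ∑ a, K.level ℓ a * (g a * mApp (K.upDown ℓ) g a) =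
      ∑ ω, K.pi ω * mApp (K.down n ℓ) g ω ^ 2 := by
    have e : ∀ ω, K.pi ω * mApp (K.down n ℓ) g ω ^ 2 =
        ∑ a, g a * mApp (K.down n ℓ) g ω * (K.pi ω * K.down n ℓ ω a) := fun ω => by
      rw [sq]
      nth_rewrite 1 [mApp]
      rw [Finset.sum_mul, Finset.mul_sum]
      exact Finset.sum_congr rfl fun a _ => by ring
    simp only [e, ← K.level_mul_up]
    rw [Finset.sum_comm]
    refine Finset.sum_congr rfl fun a _ => ?_
    rw [upDown, mApp_matMul]
    nth_rewrite 1 [mApp]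
    rw [Finset.mul_sum, Finset.mul_sum]
    exact Finset.sum_congr rfl fun b _ => by ring
  rw [← h]
  simp only [inner', expect]
  rw [← Finset.sum_sub_distrib]
  exact Finset.sum_congr rfl fun a _ => by ring

end WComplex

lemma restrict_subset {n : ℕ} {U : Type*} (ω : Finset (Fin n × U)) (T : Finset (Fin n)) :
    restrict ω T ⊆ ω :=
  Finset.filter_subset _ _

section Partite

variable {n ℓ k : ℕ} {U : Type*} [Fintype U] [DecidableEq U] {K : WComplex (Fin n × U) n}
  {H : SimpleGraph (Finset (Fin n))} {ω : Finset (Fin n × U)}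

lemma IsPartite.injOn (hpart : IsPartite K) (hω : K.pi ω ≠ 0) :
    Set.InjOn Prod.fst (ω : Set (Fin n × U)) := by
  obtain ⟨h1, h2⟩ := K.mem_faces_of_pi_ne_zero hω
  exact Finset.card_image_iff.1 ((hpart ω h1 h2).trans h2.symm)

lemma IsPartite.typ_restrict (hpart : IsPartite K) (hω : K.pi ω ≠ 0) (T : Finset (Fin n)) :
    typ (restrict ω T) = T := by
  obtain ⟨h1, h2⟩ := K.mem_faces_of_pi_ne_zero hω
  have huniv : typ ω = Finset.univ :=
    Finset.eq_univ_of_card _ ((hpart ω h1 h2).trans (Fintype.card_fin n).symm)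
  ext i
  simp only [typ, restrict, Finset.mem_image, Finset.mem_filter]
  constructor
  · rintro ⟨v, ⟨-, hv⟩, rfl⟩
    exact hv
  · intro hi
    have : i ∈ typ ω := huniv ▸ Finset.mem_univ i
    obtain ⟨v, hv, rfl⟩ := Finset.mem_image.1 this
    exact ⟨v, ⟨hv, hi⟩, rfl⟩

lemma IsPartite.restrict_typ (hpart : IsPartite K) (hω : K.pi ω ≠ 0)
    {b : Finset (Fin n × U)} (hb : b ⊆ ω) : restrict ω (typ b) = b := by
  ext v
  simp only [typ, restrict, Finset.mem_image, Finset.mem_filter]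
  constructor
  · rintro ⟨hv, w, hw, hwv⟩
    rwa [← hpart.injOn hω (hb hw) hv hwv]
  · exact fun hv => ⟨hb hv, v, hv, rfl⟩

lemma IsPartite.card_typ (hpart : IsPartite K) (hω : K.pi ω ≠ 0)
    {b : Finset (Fin n × U)} (hb : b ⊆ ω) : (typ b).card = b.card :=
  Finset.card_image_iff.2 ((hpart.injOn hω).mono (by exact_mod_cast hb))

lemma IsPartite.card_restrict (hpart : IsPartite K) (hω : K.pi ω ≠ 0) (T : Finset (Fin n)) :
    (restrict ω T).card = T.card := by
  rw [← hpart.card_typ hω (restrict_subset ω T), hpart.typ_restrict hω]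

/-- The subsets of a facet correspond to the subsets of `[n]`. -/
lemma IsPartite.sum_subset (hpart : IsPartite K) (hω : K.pi ω ≠ 0)
    (G : Finset (Fin n × U) → ℝ) :
    (∑ b, if b ⊆ ω then G b else 0) = ∑ T, G (restrict ω T) := by
  rw [← Finset.sum_filter]
  refine Finset.sum_bij' (fun b _ => typ b) (fun T _ => restrict ω T) (by simp) ?_ ?_ ?_ ?_
  · intro T _
    simpa using restrict_subset ω T
  · intro b hb
    exact hpart.restrict_typ hω (by simpa using hb)
  · intro T _
    exact hpart.typ_restrict hω T
  · intro b hb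
    rw [hpart.restrict_typ hω (by simpa using hb)]

lemma IsPartite.mApp_down (hpart : IsPartite K) (hω : K.pi ω ≠ 0)
    (g : Finset (Fin n × U) → ℝ) :
    mApp (K.down n ℓ) g ω = expect (unifSubsets n ℓ) (fun T => g (restrict ω T)) := by
  have h := hpart.sum_subset hω fun b => if b.card = ℓ then ((n.choose ℓ : ℝ))⁻¹ * g b else 0
  simp only [hpart.card_restrict hω] at h
  simp only [mApp, expect, unifSubsets, WComplex.down, ite_mul, zero_mul]
  rw [← h]
  refine Finset.sum_congr rfl fun b _ => ?_
  simp only [(K.mem_faces_of_pi_ne_zero hω).2, true_and]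
  split_ifs <;> first | rfl | tauto

lemma IsPartite.expect_level (hpart : IsPartite K) (h : Finset (Fin n × U) → ℝ) :
    expect (K.level ℓ) h =
      ∑ ω, K.pi ω * expect (unifSubsets n ℓ) (fun T => h (restrict ω T)) := by
  have e : ∀ ω, K.pi ω * expect (unifSubsets n ℓ) (fun T => h (restrict ω T)) =
      ∑ b, if b ⊆ ω then (if b.card = ℓ then ((n.choose ℓ : ℝ))⁻¹ else 0) * K.pi ω * h b
        else 0 := fun ω => by
    by_cases hω : K.pi ω = 0
    · simp [hω]
    · rw [hpart.sum_subset hω, expect, Finset.mul_sum]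
      refine Finset.sum_congr rfl fun T _ => ?_
      rw [hpart.card_restrict hω, unifSubsets]
      ring
  simp only [e]
  rw [Finset.sum_comm]
  refine Finset.sum_congr rfl fun b _ => ?_
  simp only [WComplex.level, WComplex.mass, ite_mul, zero_mul, Finset.mul_sum, Finset.sum_mul]
  by_cases hb : b.card = ℓ
  · simp only [hb, if_true]
    refine Finset.sum_congr rfl fun ω _ => ?_
    split_ifs <;> ring
  · simp [hb]

lemma expect_prodDist (h : Finset (Fin n × U) × Finset (Fin n) → ℝ) :
    expect (prodDist K ℓ) h =
      ∑ ω, K.pi ω * expect (unifSubsets n ℓ) (fun S => h (ω, S)) := by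
  simp only [expect, prodDist, Fintype.sum_prod_type, Finset.mul_sum, mul_assoc]

lemma unifSubsets_nonneg (S : Finset (Fin n)) : 0 ≤ unifSubsets n ℓ S := by
  unfold unifSubsets
  split_ifs <;> positivity

lemma isProbDist_unifSubsets (hℓ : ℓ ≤ n) : IsProbDist (unifSubsets n ℓ) := by
  refine ⟨unifSubsets_nonneg, ?_⟩
  have hc : (Finset.univ.filter fun S : Finset (Fin n) => S.card = ℓ).card = n.choose ℓ := by
    rw [Finset.univ_filter_card_eq, Finset.card_powersetCard, Finset.card_univ, Fintype.card_fin]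
  have h0 : (n.choose ℓ : ℝ) ≠ 0 := by exact_mod_cast (Nat.choose_pos hℓ).ne'
  simp only [unifSubsets]
  rw [← Finset.sum_filter, Finset.sum_const, hc, nsmul_eq_mul, mul_inv_cancel₀ h0]

lemma IsPartite.isProbDist_level (hpart : IsPartite K) (hℓ : ℓ ≤ n) :
    IsProbDist (K.level ℓ) := by
  refine ⟨K.level_nonneg, ?_⟩
  have h := hpart.expect_level (ℓ := ℓ) fun _ => 1
  have h1 := (isProbDist_unifSubsets hℓ).2
  simp only [expect, mul_one, h1, K.pi_sum] at h
  exact h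

lemma isProbDist_prodDist (hℓ : ℓ ≤ n) : IsProbDist (prodDist K ℓ) := by
  refine ⟨fun p => mul_nonneg (K.pi_nonneg _) (unifSubsets_nonneg _), ?_⟩
  have h := expect_prodDist (K := K) (ℓ := ℓ) fun _ => 1
  have h1 := (isProbDist_unifSubsets hℓ).2
  simp only [expect, mul_one, h1, K.pi_sum] at h
  exact h

lemma walkMat_nonneg (S T : Finset (Fin n)) : 0 ≤ walkMat H k S T := by
  unfold walkMat
  split_ifs <;> positivity

lemma walkMat_comm (S T : Finset (Fin n)) : walkMat H k S T = walkMat H k T S := by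
  simp only [walkMat, H.adj_comm]

lemma IsRegularOnSubsets.sum_walkMat (hreg : IsRegularOnSubsets H ℓ k) (hk : 0 < k)
    {S : Finset (Fin n)} (hS : S.card = ℓ) : ∑ T, walkMat H k S T = 1 := by
  have h0 : (k : ℝ) ≠ 0 := by exact_mod_cast hk.ne'
  simp only [walkMat]
  rw [← Finset.sum_filter, Finset.sum_const, hreg.2 S hS, nsmul_eq_mul, mul_inv_cancel₀ h0]

lemma IsRegularOnSubsets.walkMat_symm (hreg : IsRegularOnSubsets H ℓ k)
    (S T : Finset (Fin n)) :
    unifSubsets n ℓ S * walkMat H k S T = unifSubsets n ℓ T * walkMat H k T S := by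
  by_cases h : H.Adj S T
  · obtain ⟨h1, h2⟩ := hreg.1 S T h
    rw [walkMat_comm S T, unifSubsets, unifSubsets, if_pos h1, if_pos h2]
  · simp [walkMat, h, H.adj_comm T S]

lemma card_of_unifSubsets_ne_zero {S : Finset (Fin n)} (h : unifSubsets n ℓ S ≠ 0) :
    S.card = ℓ := by
  by_contra hS
  exact h (if_neg hS)

lemma IsRegularOnSubsets.isTransport (hreg : IsRegularOnSubsets H ℓ k) (hk : 0 < k) :
    IsTransport (unifSubsets n ℓ) (unifSubsets n ℓ) (walkMat H k) :=
  isTransport_of_symm walkMat_nonneg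
    (fun _ hS => hreg.sum_walkMat hk (card_of_unifSubsets_ne_zero hS)) hreg.walkMat_symm

lemma IsPartite.mApp_Qdown (hpart : IsPartite K) (hω : K.pi ω ≠ 0)
    (f : Finset (Fin n × U) → ℝ) (S : Finset (Fin n)) :
    mApp (Qdown K H k) f (ω, S) = mApp (walkMat H k) (fun T => f (restrict ω T)) S := by
  have h := hpart.sum_subset hω fun b => walkMat H k S (typ b) * f b
  simp only [hpart.typ_restrict hω] at h
  rw [mApp, mApp, ← h]
  refine Finset.sum_congr rfl fun b _ => ?_
  simp only [Qdown, walkMat]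
  split_ifs <;> first | rfl | tauto | simp

lemma Qdown_nonneg (p : Finset (Fin n × U) × Finset (Fin n)) (b : Finset (Fin n × U)) :
    0 ≤ Qdown K H k p b := by
  unfold Qdown
  split_ifs <;> positivity

lemma Qup_nonneg (b : Finset (Fin n × U)) (p : Finset (Fin n × U) × Finset (Fin n)) :
    0 ≤ Qup K H k b p := by
  unfold Qup
  refine mul_nonneg (by split_ifs <;> positivity) (div_nonneg ?_ (K.mass_nonneg b))
  split_ifs
  exacts [K.pi_nonneg _, le_rfl]

lemma IsPartite.isTransport_Qdown (hpart : IsPartite K) (hreg : IsRegularOnSubsets H ℓ k)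
    (hk : 0 < k) : IsTransport (prodDist K ℓ) (K.level ℓ) (Qdown K H k) where
  nonneg := Qdown_nonneg
  row_sum := by
    rintro ⟨ω, S⟩ hp
    obtain ⟨hω, hS⟩ := mul_ne_zero_iff.1 hp
    have h := hpart.mApp_Qdown (H := H) (k := k) hω (fun _ => 1) S
    simp only [mApp, mul_one] at h
    rw [h, hreg.sum_walkMat hk (card_of_unifSubsets_ne_zero hS)]
  expect_eq h := by
    rw [expect_prodDist, hpart.expect_level]
    refine Finset.sum_congr rfl fun ω _ => ?_
    by_cases hω : K.pi ω = 0
    · simp [hω]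
    · simp only [hpart.mApp_Qdown hω]
      exact congrArg _ ((hreg.isTransport hk).expect_eq fun T => h (restrict ω T))

/-- `Qup` is the adjoint of `Qdown`. -/
lemma IsPartite.level_mul_Qup (hpart : IsPartite K) (hreg : IsRegularOnSubsets H ℓ k)
    (b : Finset (Fin n × U)) (p : Finset (Fin n × U) × Finset (Fin n)) :
    K.level ℓ b * Qup K H k b p = prodDist K ℓ p * Qdown K H k p b := by
  obtain ⟨ω, S⟩ := p
  simp only [Qup, Qdown, prodDist]
  by_cases hS : H.Adj S (typ b)
  swap
  · simp [hS]
  by_cases hb : b ⊆ ω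
  swap
  · simp [hb]
  by_cases hω : K.pi ω = 0
  · simp [hω]
  obtain ⟨h1, h2⟩ := hreg.1 _ _ hS
  rw [hpart.card_typ hω hb] at h2
  have := K.mass_ne_zero hb hω
  simp only [hS, hb, and_self, if_true, WComplex.level, unifSubsets, h1, h2]
  field_simp

lemma IsPartite.isTransport_Qup (hpart : IsPartite K) (hreg : IsRegularOnSubsets H ℓ k)
    (hk : 0 < k) : IsTransport (K.level ℓ) (prodDist K ℓ) (Qup K H k) where
  nonneg := Qup_nonneg
  row_sum b hb := by
    have h := (hpart.isTransport_Qdown hreg hk).expect_eq fun c => if c = b then 1 else 0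
    simp only [expect, mApp, mul_ite, mul_one, mul_zero, Finset.sum_ite_eq', Finset.mem_univ,
      if_true, ← hpart.level_mul_Qup hreg] at h
    rw [← Finset.mul_sum] at h
    exact mul_left_cancel₀ hb (h.trans (mul_one _).symm)
  expect_eq h := by
    simp only [expect, mApp, Finset.mul_sum, ← mul_assoc, hpart.level_mul_Qup hreg]
    rw [Finset.sum_comm]
    refine Finset.sum_congr rfl fun p _ => ?_
    rw [← Finset.sum_mul, ← Finset.mul_sum]
    by_cases hp : prodDist K ℓ p = 0
    · simp [hp]
    · rw [(hpart.isTransport_Qdown hreg hk).row_sum p hp, mul_one]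

/-- The entropy contraction of the expanderized down-walk. -/
lemma IsPartite.ent_mApp_Qdown_le (hpart : IsPartite K) (hℓ : ℓ ≤ n)
    (hreg : IsRegularOnSubsets H ℓ k) (hk : 0 < k) {f : Finset (Fin n × U) → ℝ}
    (hf : ∀ b, 0 ≤ f b) :
    ent (prodDist K ℓ) (mApp (Qdown K H k) f) ≤
      (1 - LS (K.level ℓ) (K.upDown ℓ) * (1 - lamHsq H ℓ k)) * ent (K.level ℓ) f := by
  have hu := isProbDist_unifSubsets hℓ
  have hW := hreg.isTransport hk
  have hlam : lamHsq H ℓ k ≤ 1 := Real.sSup_le (by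
    rintro r ⟨f, h1, -, rfl⟩
    exact twoSided_sq_le_one hu.1 hW hreg.walkMat_symm h1) zero_le_one
  set g : Finset (Fin n × U) → ℝ := fun b => √(f b) with hg
  have hg0 : ∀ b, 0 ≤ g b := fun b => Real.sqrt_nonneg _
  have hgf : (fun b => g b ^ 2) = f := funext fun b => Real.sq_sqrt (hf b)
  have hD : inner' (K.level ℓ) g (fun a => g a - mApp (K.upDown ℓ) g a) =
      ∑ ω, K.pi ω * (expect (unifSubsets n ℓ) (fun T => g (restrict ω T) ^ 2) -
        expect (unifSubsets n ℓ) (fun T => g (restrict ω T)) ^ 2) := by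
    rw [K.inner'_upDown, hpart.expect_level, ← Finset.sum_sub_distrib]
    refine Finset.sum_congr rfl fun ω _ => ?_
    by_cases hω : K.pi ω = 0
    · simp [hω]
    · rw [hpart.mApp_down hω, mul_sub]
  have hD0 : 0 ≤ inner' (K.level ℓ) g (fun a => g a - mApp (K.upDown ℓ) g a) := by
    rw [hD]
    exact Finset.sum_nonneg fun ω _ => mul_nonneg (K.pi_nonneg ω)
      (sub_nonneg.2 (sq_sum_le_sum_sq hu.1 hu.2 _))
  have hLS := LS_mul_ent_le (hpart.isProbDist_level hℓ) hg0 hD0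
  have hloss := (hpart.isTransport_Qdown hreg hk).le_ent_sub_ent
    (isProbDist_prodDist hℓ).1 hg0
  have hgap : (1 - lamHsq H ℓ k) * inner' (K.level ℓ) g
      (fun a => g a - mApp (K.upDown ℓ) g a) ≤
      expect (K.level ℓ) (fun b => g b ^ 2) -
        expect (prodDist K ℓ) (fun p => mApp (Qdown K H k) g p ^ 2) := by
    rw [hD, hpart.expect_level, expect_prodDist, ← Finset.sum_sub_distrib, Finset.mul_sum]
    refine Finset.sum_le_sum fun ω _ => ?_
    by_cases hω : K.pi ω = 0
    · simp [hω]
    · simp only [hpart.mApp_Qdown hω]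
      rw [← mul_sub, mul_left_comm]
      exact mul_le_mul_of_nonneg_left
        (twoSided_sq_poincare hu hW hreg.walkMat_symm _) (K.pi_nonneg ω)
  rw [hgf] at hLS hloss hgap
  have := mul_le_mul_of_nonneg_left hLS (sub_nonneg.2 hlam)
  linarith

lemma one_lt_choose (hℓ : ℓ ≤ n) (hreg : IsRegularOnSubsets H ℓ k) (hk : 0 < k) :
    1 < n.choose ℓ := by
  obtain ⟨S, -, hS⟩ := Finset.exists_subset_card_eq
    (s := (Finset.univ : Finset (Fin n))) (n := ℓ) (by simpa using hℓ)
  have hne : (Finset.univ.filter fun T => H.Adj S T).Nonempty := by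
    rw [← Finset.card_pos, hreg.2 S hS]
    exact hk
  obtain ⟨T, hT⟩ := hne
  have hST : H.Adj S T := by simpa using hT
  have hc : (Finset.powersetCard ℓ (Finset.univ : Finset (Fin n))).card = n.choose ℓ := by
    rw [Finset.card_powersetCard, Finset.card_univ, Fintype.card_fin]
  rw [← hc, Finset.one_lt_card]
  exact ⟨S, by simp [hS], T, by simp [(hreg.1 S T hST).2], hST.ne⟩

/-- An indicator function of an event of probability strictly between `0` and `1` has
positive entropy. -/
lemma ent_indicator_pos {α : Type*} [Fintype α] {μ : α → ℝ} {p : α → Prop} [DecidablePred p]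
    (h0 : 0 < expect μ fun x => if p x then 1 else 0)
    (h1 : expect μ (fun x => if p x then 1 else 0) < 1) :
    0 < ent μ fun x => if p x then 1 else 0 := by
  have h : expect μ (fun x => nlog (if p x then 1 else 0)) = 0 :=
    Finset.sum_eq_zero fun x _ => by by_cases hx : p x <;> simp [nlog, hx]
  rw [ent, phiEnt, h, nlog]
  nlinarith [Real.log_neg h0 h1]

lemma exists_ent_pos (hpart : IsPartite K) (hℓ : ℓ ≤ n) (hreg : IsRegularOnSubsets H ℓ k)
    (hk : 0 < k) :
    (∃ f : Finset (Fin n × U) → ℝ, (∀ b, 0 ≤ f b) ∧ 0 < ent (K.level ℓ) f) ∧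
      ∃ f : Finset (Fin n × U) × Finset (Fin n) → ℝ,
        (∀ p, 0 ≤ f p) ∧ 0 < ent (prodDist K ℓ) f := by
  obtain ⟨S, -, hS⟩ := Finset.exists_subset_card_eq
    (s := (Finset.univ : Finset (Fin n))) (n := ℓ) (by simpa using hℓ)
  have hu : expect (unifSubsets n ℓ) (fun T => if T = S then 1 else 0) =
      ((n.choose ℓ : ℝ))⁻¹ := by
    simp [expect, unifSubsets, hS]
  have hc : (1 : ℝ) < n.choose ℓ := by exact_mod_cast one_lt_choose hℓ hreg hk
  have h1 : expect (K.level ℓ) (fun b => if typ b = S then 1 else 0) =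
      ((n.choose ℓ : ℝ))⁻¹ := by
    rw [hpart.expect_level, ← hu, ← one_mul (expect _ _), ← K.pi_sum, Finset.sum_mul]
    refine Finset.sum_congr rfl fun ω _ => ?_
    by_cases hω : K.pi ω = 0
    · simp [hω]
    · simp only [hpart.typ_restrict hω]
  have h2 : expect (prodDist K ℓ) (fun p => if p.2 = S then 1 else 0) =
      ((n.choose ℓ : ℝ))⁻¹ := by
    rw [expect_prodDist]
    simp only [hu]
    rw [← Finset.sum_mul, K.pi_sum, one_mul]
  have hpos : 0 < ((n.choose ℓ : ℝ))⁻¹ := by positivity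
  have hlt : ((n.choose ℓ : ℝ))⁻¹ < 1 := inv_lt_one_of_one_lt₀ hc
  exact ⟨⟨fun b => if typ b = S then 1 else 0, fun b => by dsimp only; split_ifs <;> norm_num,
      ent_indicator_pos (by rwa [h1]) (by rwa [h1])⟩,
    ⟨fun p => if p.2 = S then 1 else 0, fun p => by dsimp only; split_ifs <;> norm_num,
      ent_indicator_pos (by rwa [h2]) (by rwa [h2])⟩⟩

end Partite

end Expanderized

open Expanderized WComplex in
/-- `EC(Qdo) ≥ LS(Udw_{ℓ↔n})·Gap*(H²)`, and consequently for
`Papx' = Qup·Qdo` (the expanderized up-down walk via `H²`) and `Paqx = Qdo·Qup`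
(the expanderized down-up walk via `H`):
`EC(Papx') ≥ LS(Udw_{ℓ↔n})·Gap*(H²)` and `EC(Paqx) ≥ LS(Udw_{ℓ↔n})·Gap*(H²)`. -/
theorem statement3 {n ℓ k : ℕ} {U : Type*} [Fintype U] [DecidableEq U]
    (K : WComplex (Fin n × U) n) (hpart : IsPartite K) (hℓ : ℓ ≤ n)
    (H : SimpleGraph (Finset (Fin n))) (hreg : IsRegularOnSubsets H ℓ k) (hk : 0 < k) :
    LS (K.level ℓ) (K.upDown ℓ) * (1 - lamHsq H ℓ k) ≤
        EC (prodDist K ℓ) (K.level ℓ) (Qdown K H k) ∧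
      LS (K.level ℓ) (K.upDown ℓ) * (1 - lamHsq H ℓ k) ≤
        EC (K.level ℓ) (K.level ℓ) (matMul (Qup K H k) (Qdown K H k)) ∧
      LS (K.level ℓ) (K.upDown ℓ) * (1 - lamHsq H ℓ k) ≤
        EC (prodDist K ℓ) (prodDist K ℓ) (expDownUp K H k) := by
  have hu := isProbDist_unifSubsets hℓ
  have hlam : lamHsq H ℓ k ≤ 1 := Real.sSup_le (by
    rintro r ⟨f, h1, -, rfl⟩
    exact twoSided_sq_le_one hu.1 (hreg.isTransport hk) hreg.walkMat_symm h1) zero_le_one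
  have hC0 := mul_nonneg (LS_nonneg (K.level ℓ) (K.upDown ℓ)) (sub_nonneg.2 hlam)
  have hlev := hpart.isProbDist_level hℓ
  have hprod := isProbDist_prodDist (K := K) hℓ
  have hdown := hpart.isTransport_Qdown hreg hk
  have hup := hpart.isTransport_Qup hreg hk
  obtain ⟨⟨f₁, hf₁, hpos₁⟩, f₂, hf₂, hpos₂⟩ := exists_ent_pos hpart hℓ hreg hk
  have hcontr := fun (f : Finset (Fin n × U) → ℝ) hf =>
    hpart.ent_mApp_Qdown_le hℓ hreg hk (f := f) hf
  have hC1 := le_one_of_contraction hprod hdown.nonneg hf₁ hpos₁ (hcontr f₁ hf₁)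
  refine ⟨le_EC hprod hdown.nonneg hf₁ hpos₁ hC0 hcontr,
    le_EC hlev (matMul_nonneg hup.nonneg hdown.nonneg) hf₁ hpos₁ hC0 fun f hf => ?_,
    le_EC hprod (matMul_nonneg hdown.nonneg hup.nonneg) hf₂ hpos₂ hC0 fun f hf => ?_⟩
  · rw [mApp_matMul]
    exact (hup.ent_mApp_le hlev.1 (mApp_nonneg hdown.nonneg hf)).trans (hcontr f hf)
  · rw [mApp_matMul]
    exact (hcontr _ (mApp_nonneg hup.nonneg hf)).trans
      (mul_le_mul_of_nonneg_left (hup.ent_mApp_le hlev.1 hf) (sub_nonneg.2 hC1))
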